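/- Let l, m, n be integers with m ≤ l and m < n, let Λ ⊂ ℝ^l be open, and let {P_λ : ℝⁿ → ℝ^m}_{λ∈Λ} be a transversal family of maps. If F ⊂ ℝⁿ is H^m-measurable, m-rectifiable and H^m(F) > 0, then H^m(P_λ(F)) > 0 for L^l-almost every λ ∈ Λ. -/

import Mathlib

open MeasureTheory Set Metric Matrix

/-- The matrix of a continuous linear map between Euclidean spaces with respect to the
standard bases. -/
noncomputable def matrixOf {l m : ℕ}
    (L : EuclideanSpace ℝ (Fin l) →L[ℝ] EuclideanSpace ℝ (Fin m)) :
    Matrix (Fin m) (Fin l) ℝ :=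
  fun i j => L (EuclideanSpace.single j 1) i

/-- `Tmap P x y` is the map `λ ↦ (P_λ(x) - P_λ(y)) / |x - y|`. -/
noncomputable def Tmap {l n m : ℕ}
    (P : EuclideanSpace ℝ (Fin l) → EuclideanSpace ℝ (Fin n) → EuclideanSpace ℝ (Fin m))
    (x y : EuclideanSpace ℝ (Fin n)) (lam : EuclideanSpace ℝ (Fin l)) :
    EuclideanSpace ℝ (Fin m) :=
  ‖x - y‖⁻¹ • (P lam x - P lam y)

/-- A family of maps `{P_λ : ℝⁿ → ℝ^m}_{λ ∈ Λ}` is transversal if for every compact `K ⊆ ℝⁿ`: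
(1) `(λ,x) ↦ P_λ(x)` is continuously differentiable on `Λ × K` and twice differentiable with
respect to `λ`; (2) the first and second derivatives with respect to `λ` are uniformly bounded;
(3) whenever `|T_{x,y}(λ)| ≤ C_T`, then `det (D_λ T_{x,y}(λ) (D_λ T_{x,y}(λ))ᵀ) ≥ C_T ^ 2`;
(4) the second derivative of `T_{x,y}` with respect to `λ` is uniformly bounded. -/
def IsTransversalFamily {l n m : ℕ} (Λ : Set (EuclideanSpace ℝ (Fin l)))
    (P : EuclideanSpace ℝ (Fin l) → EuclideanSpace ℝ (Fin n) → EuclideanSpace ℝ (Fin m)) :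
    Prop :=
  ∀ K : Set (EuclideanSpace ℝ (Fin n)), IsCompact K →
    -- (1)
    ((ContDiffOn ℝ 1 (fun p => P p.1 p.2) (Λ ×ˢ K) ∧
      ∀ lam ∈ Λ, ∀ x ∈ K, DifferentiableAt ℝ (fun μ => P μ x) lam ∧
        DifferentiableAt ℝ (fun μ => fderiv ℝ (fun ν => P ν x) μ) lam) ∧
    -- (2)
    (∃ C₁ C₂ : ℝ, ∀ lam ∈ Λ, ∀ x ∈ K,
      ‖fderiv ℝ (fun μ => P μ x) lam‖ ≤ C₁ ∧
      ‖fderiv ℝ (fun μ => fderiv ℝ (fun ν => P ν x) μ) lam‖ ≤ C₂) ∧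
    -- (3)
    (∃ C_T : ℝ, 0 < C_T ∧ ∀ lam ∈ Λ, ∀ x ∈ K, ∀ y ∈ K, x ≠ y →
      ‖Tmap P x y lam‖ ≤ C_T →
      C_T ^ 2 ≤
        (matrixOf (fderiv ℝ (Tmap P x y) lam) * (matrixOf (fderiv ℝ (Tmap P x y) lam))ᵀ).det) ∧
    -- (4)
    (∃ C_L : ℝ, ∀ lam ∈ Λ, ∀ x ∈ K, ∀ y ∈ K, x ≠ y →
      ‖fderiv ℝ (fun μ => fderiv ℝ (Tmap P x y) μ) lam‖ ≤ C_L))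

/-- A set `F ⊆ ℝⁿ` is `m`-rectifiable if there are countably many Lipschitz maps
`f_i : ℝ^m → ℝⁿ` with `H^m (F \ ⋃ i, f_i(ℝ^m)) = 0`. -/
def MRectifiable (m n : ℕ) (F : Set (EuclideanSpace ℝ (Fin n))) : Prop :=
  ∃ f : ℕ → EuclideanSpace ℝ (Fin m) → EuclideanSpace ℝ (Fin n),
    (∀ i, ∃ K : NNReal, LipschitzWith K (f i)) ∧
    μH[m] (F \ ⋃ i, Set.range (f i)) = 0

open Filter Topology
open scoped NNReal ENNReal

/-- If `f` increases distances on `s` at most `K` times as much as `g` does, then the Hausdorff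
measure of `f '' s` is controlled by that of `g '' s`. -/
theorem hausdorffMeasure_image_le_of_edist_le {X Y Z : Type*} [EMetricSpace Y] [EMetricSpace Z]
    [MeasurableSpace Y] [BorelSpace Y] [MeasurableSpace Z] [BorelSpace Z]
    {f : X → Y} {g : X → Z} {s : Set X} {K : ℝ≥0} {d : ℝ} (hd : 0 ≤ d)
    (h : ∀ x ∈ s, ∀ y ∈ s, edist (f x) (f y) ≤ K * edist (g x) (g y)) :
    μH[d] (f '' s) ≤ (K : ℝ≥0∞) ^ d * μH[d] (g '' s) := by
  rcases s.eq_empty_or_nonempty with rfl | ⟨x₀, -⟩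
  · simp
  have : Nonempty X := ⟨x₀⟩
  have hinv : ∀ x ∈ s, Function.invFunOn g s (g x) ∈ s ∧ g (Function.invFunOn g s (g x)) = g x :=
    fun x hx => ⟨Function.invFunOn_mem ⟨x, hx, rfl⟩, Function.invFunOn_eq ⟨x, hx, rfl⟩⟩
  have hfx : ∀ x ∈ s, f (Function.invFunOn g s (g x)) = f x := by
    intro x hx
    have := h _ (hinv x hx).1 x hx
    rw [(hinv x hx).2, edist_self, mul_zero] at this
    exact edist_le_zero.1 this
  have hlip : LipschitzOnWith K (f ∘ Function.invFunOn g s) (g '' s) := by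
    rintro _ ⟨x, hx, rfl⟩ _ ⟨y, hy, rfl⟩
    simp only [Function.comp_apply, hfx x hx, hfx y hy]
    exact h x hx y hy
  have himg : f '' s = (f ∘ Function.invFunOn g s) '' (g '' s) := by
    rw [image_image]
    exact image_congr fun x hx => (hfx x hx).symm
  rw [himg]
  exact hlip.hausdorffMeasure_image_le hd

section Sard

variable {E F : Type*} [NormedAddCommGroup E] [InnerProductSpace ℝ E] [FiniteDimensional ℝ E]
  [NormedAddCommGroup F] [NormedSpace ℝ F]

/-- A non-injective linear map `A` is dominated, even after adding `δ ‖v‖`, by an endomorphism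
of arbitrarily small determinant. -/
theorem exists_dominating_endomorphism {A : E →L[ℝ] F} (hA : ¬ Function.Injective A) {ε : ℝ}
    (hε : 0 < ε) :
    ∃ δ : ℝ≥0, 0 < δ ∧ ∃ B : E →L[ℝ] E, |B.det| < ε ∧
      ∀ v, ‖A v‖ + δ * ‖v‖ ≤ 2 * ‖B v‖ := by
  obtain ⟨e, he1, hAe⟩ : ∃ e : E, ‖e‖ = 1 ∧ A e = 0 := by
    rw [injective_iff_map_eq_zero] at hA
    push Not at hA
    obtain ⟨u, hu, hu0⟩ := hA
    have : ‖u‖ ≠ 0 := norm_ne_zero_iff.2 hu0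
    exact ⟨‖u‖⁻¹ • u, by rw [norm_smul, norm_inv, norm_norm, inv_mul_cancel₀ this], by simp [hu]⟩
  set B : ℝ → E →L[ℝ] E := fun δ =>
    (‖A‖ + δ) • ContinuousLinearMap.id ℝ E - ‖A‖ • (innerSL ℝ e).smulRight e with hB
  have hBv : ∀ δ v, B δ v = (‖A‖ + δ) • v - ‖A‖ • (inner ℝ e v : ℝ) • e := by
    intro δ v
    simp [hB]
  have hcont : Continuous fun δ => |(B δ).det| := by
    have : Continuous B := by fun_prop
    exact (ContinuousLinearMap.continuous_det.comp this).abs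
  have h0 : |(B 0).det| = 0 := by
    rw [abs_eq_zero]
    have hBe : B 0 e = 0 := by
      rw [hBv]
      simp [he1]
    by_contra hdet
    have hinj : Function.Injective (B 0) :=
      ((B 0).toContinuousLinearEquivOfDetNeZero hdet).injective
    have : e = 0 := hinj (by rw [hBe, map_zero])
    simp [this] at he1
  have hev : ∀ᶠ δ in 𝓝[>] (0 : ℝ), |(B δ).det| < ε :=
    (hcont.continuousAt.eventually_lt_const (h0.trans_lt hε)).filter_mono
      nhdsWithin_le_nhds
  obtain ⟨δ, hδε, hδ⟩ := (hev.and self_mem_nhdsWithin).exists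
  have hδ0 : (0 : ℝ) < δ := hδ
  refine ⟨⟨δ, hδ0.le⟩, hδ0, B δ, hδε, fun v => ?_⟩
  change ‖A v‖ + δ * ‖v‖ ≤ 2 * ‖B δ v‖
  set c : ℝ := inner ℝ e v with hc
  set q : E := v - c • e with hq
  have hqe : inner ℝ q e = 0 := by
    rw [hq, inner_sub_left, inner_smul_left, real_inner_self_eq_norm_sq, he1, hc,
      real_inner_comm]
    simp
  have hv : v = q + c • e := by simp [hq]
  have hBq : B δ v = (‖A‖ + δ) • q + (δ * c) • e := by
    rw [hBv, ← hc, hv]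
    module
  have hce : ‖c • e‖ ^ 2 = c ^ 2 := by
    rw [norm_smul, he1, mul_one, Real.norm_eq_abs, sq_abs]
  have hnv : ‖v‖ ^ 2 = ‖q‖ ^ 2 + c ^ 2 := by
    rw [hv, norm_add_sq_real, inner_smul_right, hqe, hce]
    ring
  have hnB : ‖B δ v‖ ^ 2 = (‖A‖ + δ) ^ 2 * ‖q‖ ^ 2 + δ ^ 2 * c ^ 2 := by
    rw [hBq, norm_add_sq_real, inner_smul_right, inner_smul_left, hqe, norm_smul, norm_smul, he1]
    simp only [Real.norm_eq_abs, mul_pow, sq_abs]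
    ring
  have hAv : A v = A q := by
    rw [hv, map_add, map_smul, hAe]
    simp
  have hA0 : 0 ≤ ‖A‖ := norm_nonneg _
  have h1 : ‖A v‖ ≤ ‖B δ v‖ := by
    rw [hAv]
    refine (A.le_opNorm q).trans (abs_le_of_sq_le_sq' ?_ (norm_nonneg _)).2
    rw [hnB, mul_pow]
    have : ‖A‖ ^ 2 ≤ (‖A‖ + δ) ^ 2 := by gcongr; linarith
    nlinarith [mul_le_mul_of_nonneg_right this (sq_nonneg ‖q‖), sq_nonneg (δ * c)]
  have h2 : δ * ‖v‖ ≤ ‖B δ v‖ := by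
    refine (abs_le_of_sq_le_sq' ?_ (norm_nonneg _)).2
    rw [hnB, mul_pow, hnv]
    have : δ ^ 2 ≤ (‖A‖ + δ) ^ 2 := by gcongr; linarith
    nlinarith [mul_le_mul_of_nonneg_right this (sq_nonneg ‖q‖)]
  linarith

variable [MeasurableSpace E] [BorelSpace E] [MeasurableSpace F] [BorelSpace F]

/-- Maps that are close to a non-injective linear map shrink Hausdorff measure arbitrarily much. -/
theorem exists_hausdorffMeasure_image_le_of_not_injective {A : E →L[ℝ] F}
    (hA : ¬ Function.Injective A) {ε : ℝ≥0} (hε : 0 < ε) :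
    ∃ δ : ℝ≥0, 0 < δ ∧ ∀ (s : Set E) (f : E → F), ApproximatesLinearOn f A s δ →
      μH[Module.finrank ℝ E] (f '' s) ≤ ε * μH[Module.finrank ℝ E] s := by
  set d := Module.finrank ℝ E
  obtain ⟨δ, hδ, B, hdet, hB⟩ :=
    exists_dominating_endomorphism hA (ε := ε / 2 ^ d) (by positivity)
  refine ⟨δ, hδ, fun s f hf => ?_⟩
  have hle : ∀ x ∈ s, ∀ y ∈ s, edist (f x) (f y) ≤ (2 : ℝ≥0) * edist (B x) (B y) := by
    intro x hx y hy
    rw [edist_nndist, edist_nndist, ← ENNReal.coe_mul, ENNReal.coe_le_coe, ← NNReal.coe_le_coe]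
    simp only [coe_nndist, NNReal.coe_mul, NNReal.coe_ofNat, dist_eq_norm]
    have h1 := hf x hx y hy
    have h2 := hB (x - y)
    rw [← map_sub]
    calc ‖f x - f y‖ = ‖(f x - f y - A (x - y)) + A (x - y)‖ := by rw [sub_add_cancel]
      _ ≤ ‖f x - f y - A (x - y)‖ + ‖A (x - y)‖ := norm_add_le _ _
      _ ≤ _ := by linarith
  refine (hausdorffMeasure_image_le_of_edist_le (Nat.cast_nonneg d) hle).trans ?_
  have : (μH[d] : Measure E).IsAddHaarMeasure := isAddHaarMeasure_hausdorffMeasure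
  rw [Measure.addHaar_image_continuousLinearMap, ← mul_assoc]
  gcongr
  rw [ENNReal.rpow_natCast]
  have : ENNReal.ofReal |B.det| ≤ ENNReal.ofReal (ε / 2 ^ d) := ENNReal.ofReal_le_ofReal hdet.le
  calc ((2 : ℝ≥0) : ℝ≥0∞) ^ d * ENNReal.ofReal |B.det|
      ≤ ((2 : ℝ≥0) : ℝ≥0∞) ^ d * ENNReal.ofReal (ε / 2 ^ d) := by gcongr
    _ = ENNReal.ofReal (2 ^ d * (ε / 2 ^ d)) := by
        rw [ENNReal.ofReal_mul (by positivity), ENNReal.ofReal_pow (by norm_num)]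
        simp
    _ = ε := by
        rw [mul_div_cancel₀ _ (by positivity)]
        simp

/-- Sard-type lemma: the image of the set of points where the derivative is not injective is
null for the Hausdorff measure of the dimension of the source. -/
theorem hausdorffMeasure_image_eq_zero_of_fderivWithin_not_injective
    [SecondCountableTopology F] {f : E → F} {f' : E → E →L[ℝ] F} {s : Set E}
    (hf : ∀ x ∈ s, HasFDerivWithinAt f (f' x) s x)
    (hinj : ∀ x ∈ s, ¬ Function.Injective (f' x)) :
    μH[Module.finrank ℝ E] (f '' s) = 0 := by
  set d := Module.finrank ℝ E
  have : (μH[d] : Measure E).IsAddHaarMeasure := isAddHaarMeasure_hausdorffMeasure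
  have hbdd : ∀ u ⊆ s, μH[d] u ≠ ∞ → μH[d] (f '' u) = 0 := by
    intro u hus hu
    have key : ∀ ε : ℝ≥0, 0 < ε → μH[d] (f '' u) ≤ ε * μH[d] u := by
      intro ε hε
      have hr : ∀ A : E →L[ℝ] F, ∃ δ : ℝ≥0, δ ≠ 0 ∧ (¬ Function.Injective A →
          ∀ (s : Set E) (f : E → F), ApproximatesLinearOn f A s δ →
            μH[d] (f '' s) ≤ ε * μH[d] s) := by
        intro A
        by_cases hA : Function.Injective A
        · exact ⟨1, one_ne_zero, fun h => absurd hA h⟩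
        · obtain ⟨δ, hδ, h⟩ := exists_hausdorffMeasure_image_le_of_not_injective hA hε
          exact ⟨δ, hδ.ne', fun _ => h⟩
      choose r hr0 hr using hr
      obtain ⟨t, A, hdisj, hmeas, hcov, happ, hmem⟩ :=
        exists_partition_approximatesLinearOn_of_hasFDerivWithinAt f u f'
          (fun x hx => (hf x (hus hx)).mono hus) r hr0
      rcases u.eq_empty_or_nonempty with rfl | hne
      · simp
      have hpiece : ∀ n, μH[d] (f '' (u ∩ t n)) ≤ ε * μH[d] (u ∩ t n) := by
        intro n
        refine hr (A n) ?_ _ _ (happ n)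
        obtain ⟨y, hy, hAy⟩ := hmem hne n
        rw [hAy]
        exact hinj y (hus hy)
      calc μH[d] (f '' u) ≤ μH[d] (⋃ n, f '' (u ∩ t n)) := by
            rw [← image_iUnion, ← inter_iUnion, inter_eq_left.2 hcov]
        _ ≤ ∑' n, μH[d] (f '' (u ∩ t n)) := measure_iUnion_le _
        _ ≤ ∑' n, ε * μH[d] (u ∩ t n) := ENNReal.tsum_le_tsum hpiece
        _ = ε * ∑' n, (μH[d]).restrict u (t n) := by
            rw [ENNReal.tsum_mul_left]
            simp_rw [Measure.restrict_apply (hmeas _), inter_comm]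
        _ = ε * (μH[d]).restrict u (⋃ n, t n) := by rw [measure_iUnion hdisj hmeas]
        _ ≤ ε * μH[d] u := by
            refine mul_le_mul_right ?_ _
            rw [Measure.restrict_apply (MeasurableSet.iUnion hmeas)]
            exact measure_mono inter_subset_right
    by_contra hne
    have htend : Tendsto (fun ε : ℝ≥0 => (ε : ℝ≥0∞) * μH[d] u) (𝓝[>] 0) (𝓝 0) := by
      have h1 : Tendsto (fun ε : ℝ≥0 => (ε : ℝ≥0∞)) (𝓝[>] 0) (𝓝 ((0 : ℝ≥0) : ℝ≥0∞)) :=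
        (ENNReal.continuous_coe.tendsto _).mono_left nhdsWithin_le_nhds
      simpa using ENNReal.Tendsto.mul_const h1 (Or.inr hu)
    exact hne (le_antisymm
      (ge_of_tendsto htend (by filter_upwards [self_mem_nhdsWithin] with ε hε using key ε hε))
      bot_le)
  have hs : f '' s ⊆ ⋃ n : ℕ, f '' (s ∩ closedBall 0 n) := by
    rw [← image_iUnion, ← inter_iUnion, iUnion_closedBall_nat, inter_univ]
  refine measure_mono_null hs (measure_iUnion_null fun n => hbdd _ inter_subset_left ?_)
  exact ((measure_mono inter_subset_right).trans_lt
    (isCompact_closedBall (0 : E) (n : ℝ)).measure_lt_top).ne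

end Sard

/-- A map whose derivative is invertible on `s` maps `s` to a null set only if `s` is null. -/
theorem addHaar_eq_zero_of_addHaar_image_eq_zero {E : Type*} [NormedAddCommGroup E]
    [NormedSpace ℝ E] [FiniteDimensional ℝ E] [MeasurableSpace E] [BorelSpace E]
    (μ : Measure E) [μ.IsAddHaarMeasure] {g : E → E} {g' : E → E →L[ℝ] E} {s : Set E}
    (hg : ∀ x ∈ s, HasFDerivWithinAt g (g' x) s x) (hdet : ∀ x ∈ s, (g' x).det ≠ 0)
    (h : μ (g '' s) = 0) : μ s = 0 := by
  have hr : ∀ A : E →L[ℝ] E, ∃ δ : ℝ≥0, δ ≠ 0 ∧ (A.det ≠ 0 →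
      ∀ (s : Set E) (f : E → E), ApproximatesLinearOn f A s δ → μ (f '' s) = 0 → μ s = 0) := by
    intro A
    by_cases hA : A.det = 0
    · exact ⟨1, one_ne_zero, fun h => absurd hA h⟩
    · have hpos : (0 : ℝ≥0∞) < ENNReal.ofReal |A.det| := ENNReal.ofReal_pos.2 (abs_pos.2 hA)
      obtain ⟨c, hc0, hc⟩ := ENNReal.lt_iff_exists_nnreal_btwn.1 hpos
      obtain ⟨δ, hδ, hδ0⟩ := ((mul_le_addHaar_image_of_lt_det μ A hc).and
        self_mem_nhdsWithin).exists
      refine ⟨δ, (show 0 < δ from hδ0).ne', fun _ s f hf h0 => ?_⟩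
      have := hδ s f hf
      rw [h0, nonpos_iff_eq_zero, mul_eq_zero] at this
      exact this.resolve_left hc0.ne'
  choose r hr0 hr using hr
  obtain ⟨t, A, -, -, hcov, happ, hmem⟩ :=
    exists_partition_approximatesLinearOn_of_hasFDerivWithinAt g s g' hg r hr0
  rcases s.eq_empty_or_nonempty with rfl | hne
  · simp
  rw [← inter_eq_left.2 hcov, inter_iUnion]
  refine measure_iUnion_null fun n => hr (A n) ?_ _ _ (happ n)
    (measure_mono_null (image_mono inter_subset_left) h)
  obtain ⟨y, hy, hAy⟩ := hmem hne n
  rw [hAy]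
  exact hdet y hy

/-- Pointwise limits of maps with uniformly good affine approximations near `a` are strictly
differentiable at `a`. -/
theorem exists_hasStrictFDerivAt_of_tendsto {E G : Type*} [NormedAddCommGroup E]
    [NormedSpace ℝ E] [FiniteDimensional ℝ E] [NormedAddCommGroup G] [NormedSpace ℝ G]
    [FiniteDimensional ℝ G] {g : ℕ → E → G} {g₀ : E → G} {L : ℕ → E →L[ℝ] G} {a : E} {C R : ℝ}
    (hR : 0 < R)
    (happ : ∀ n, ∀ r ≤ R, ∀ x ∈ ball a r, ∀ y ∈ ball a r,
      ‖g n y - g n x - L n (y - x)‖ ≤ C * r * ‖y - x‖)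
    (hlim : ∀ x ∈ ball a R, Tendsto (fun n => g n x) atTop (𝓝 (g₀ x))) :
    ∃ (L₀ : E →L[ℝ] G) (φ : ℕ → ℕ), StrictMono φ ∧
      Tendsto (fun n => L (φ n)) atTop (𝓝 L₀) ∧ HasStrictFDerivAt g₀ L₀ a := by
  have : CompleteSpace E := FiniteDimensional.complete ℝ E
  have haR : a ∈ ball a R := mem_ball_self hR
  have hbdd : ∃ C', ∀ n, ‖L n‖ ≤ C' := by
    refine banach_steinhaus fun v => ?_
    obtain ⟨c, hc0, hc⟩ : ∃ c : ℝ, 0 < c ∧ a + c • v ∈ ball a R := by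
      have hcont : Continuous fun c : ℝ => a + c • v := by fun_prop
      have h0 : ∀ᶠ c in 𝓝[>] (0 : ℝ), a + c • v ∈ ball a R :=
        (hcont.continuousAt.eventually_mem (x := 0)
          (isOpen_ball.mem_nhds (by simpa using hR))).filter_mono nhdsWithin_le_nhds
      obtain ⟨c, h1, h2⟩ := (h0.and self_mem_nhdsWithin).exists
      exact ⟨c, h2, h1⟩
    obtain ⟨D, hD⟩ := ((hlim _ hc).sub (hlim _ haR)).norm.bddAbove_range
    refine ⟨c⁻¹ * (D + C * R * ‖c • v‖), fun n => ?_⟩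
    have h1 := happ n R le_rfl a haR _ hc
    rw [add_sub_cancel_left] at h1
    have h2 : ‖g n (a + c • v) - g n a‖ ≤ D := hD ⟨n, rfl⟩
    have h3 : ‖L n (c • v)‖ ≤ D + C * R * ‖c • v‖ := by
      calc ‖L n (c • v)‖ = ‖(g n (a + c • v) - g n a)
            - (g n (a + c • v) - g n a - L n (c • v))‖ := by rw [sub_sub_cancel]
        _ ≤ _ := (norm_sub_le _ _).trans (add_le_add h2 h1)
    rw [map_smul, norm_smul, Real.norm_of_nonneg hc0.le] at h3
    rw [le_inv_mul_iff₀ hc0]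
    exact h3
  obtain ⟨C', hC'⟩ := hbdd
  obtain ⟨L₀, -, φ, hφ, hL⟩ := tendsto_subseq_of_bounded
    (isBounded_closedBall (x := (0 : E →L[ℝ] G)) (r := C')) (x := L)
    (fun n => by simpa using hC' n)
  refine ⟨L₀, φ, hφ, hL, ?_⟩
  have happ₀ : ∀ r ≤ R, ∀ x ∈ ball a r, ∀ y ∈ ball a r,
      ‖g₀ y - g₀ x - L₀ (y - x)‖ ≤ C * r * ‖y - x‖ := by
    intro r hr x hx y hy
    have hx' := (hlim x (ball_subset_ball hr hx)).comp hφ.tendsto_atTop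
    have hy' := (hlim y (ball_subset_ball hr hy)).comp hφ.tendsto_atTop
    have hL' : Tendsto (fun n => L (φ n) (y - x)) atTop (𝓝 (L₀ (y - x))) :=
      ((ContinuousLinearMap.apply ℝ G (y - x)).continuous.tendsto L₀).comp hL
    exact le_of_tendsto ((hy'.sub hx').sub hL').norm
      (Eventually.of_forall fun n => happ (φ n) r hr x hx y hy)
  rw [hasStrictFDerivAt_iff_isLittleO, Asymptotics.isLittleO_iff]
  intro ε hε
  obtain ⟨r, hr0, hrR, hrε⟩ : ∃ r : ℝ, 0 < r ∧ r ≤ R ∧ C * r ≤ ε := by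
    have hcont : Continuous fun r : ℝ => C * r := by fun_prop
    have h0 : ∀ᶠ r in 𝓝[>] (0 : ℝ), C * r < ε :=
      (hcont.continuousAt.eventually_lt_const (by simpa using hε)).filter_mono nhdsWithin_le_nhds
    obtain ⟨r, ⟨h1, h2⟩, h3⟩ := ((h0.and self_mem_nhdsWithin).and
      ((eventually_le_nhds hR).filter_mono nhdsWithin_le_nhds)).exists
    exact ⟨r, h2, h3, h1.le⟩
  filter_upwards [prod_mem_nhds (ball_mem_nhds a hr0) (ball_mem_nhds a hr0)] with p hp
  exact (happ₀ r hrR p.2 hp.2 p.1 hp.1).trans (by gcongr)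

/-- If the zero `(a, w)` of a map on `E × W` into a space of dimension larger than that of `W` is
regular, then the zeros near it project to a null set of `E`. -/
theorem exists_nhds_hausdorffMeasure_fst_image_eq_zero {E W G : Type*} [NormedAddCommGroup E]
    [NormedSpace ℝ E] [FiniteDimensional ℝ E] [MeasurableSpace E] [BorelSpace E]
    [NormedAddCommGroup W] [NormedSpace ℝ W] [FiniteDimensional ℝ W] [NormedAddCommGroup G]
    [NormedSpace ℝ G] [FiniteDimensional ℝ G]
    (hdim : Module.finrank ℝ W < Module.finrank ℝ G) {Ψ : E × W → G} {Ψ' : E × W →L[ℝ] G}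
    {p : E × W} (hΨ : HasStrictFDerivAt Ψ Ψ' p) (hsurj : Function.Surjective Ψ') :
    ∃ U ∈ 𝓝 p, μH[Module.finrank ℝ E] (Prod.fst '' {q ∈ U | Ψ q = Ψ p}) = 0 := by
  have : CompleteSpace E := FiniteDimensional.complete ℝ E
  have : CompleteSpace W := FiniteDimensional.complete ℝ W
  have hrange : (Ψ' : E × W →ₗ[ℝ] G).range = ⊤ := LinearMap.range_eq_top.2 hsurj
  set h := hΨ.implicitFunction Ψ Ψ' hrange (Ψ p) with hh
  obtain ⟨K, S, hS, hlip⟩ := (hΨ.to_implicitFunction hrange).exists_lipschitzOnWith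
  set e := hΨ.implicitToOpenPartialHomeomorph Ψ Ψ' hrange with he
  have hcont : ContinuousAt (fun q => (e q).2) p :=
    continuousAt_snd.comp (e.continuousAt (hΨ.mem_implicitToOpenPartialHomeomorph_source hrange))
  have hep : (e p).2 = 0 := by
    rw [he, hΨ.implicitToOpenPartialHomeomorph_self hrange]
  have hmem : ∀ᶠ q in 𝓝 p, (e q).2 ∈ S := hcont.eventually_mem (by rw [hep]; exact hS)
  refine ⟨_, hmem.and (hΨ.eq_implicitFunction hrange), ?_⟩
  have hsub : Prod.fst '' {q ∈ {q | (e q).2 ∈ S ∧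
      hΨ.implicitFunction Ψ Ψ' hrange (Ψ q) (e q).2 = q} | Ψ q = Ψ p} ⊆
      (Prod.fst ∘ h) '' S := by
    rintro _ ⟨q, ⟨⟨hqS, hq⟩, hΨq⟩, rfl⟩
    refine ⟨(e q).2, hqS, ?_⟩
    rw [hΨq] at hq
    simp only [Function.comp_apply, hh, hq]
  refine measure_mono_null hsub ?_
  have hdimker : Module.finrank ℝ (Ψ' : E × W →ₗ[ℝ] G).ker < Module.finrank ℝ E := by
    have h1 := (Ψ' : E × W →ₗ[ℝ] G).finrank_range_add_finrank_ker
    rw [hrange, finrank_top, Module.finrank_prod] at h1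
    omega
  have hlt : dimH ((Prod.fst ∘ h) '' S) < (Module.finrank ℝ E : ℝ≥0) := by
    refine ((LipschitzWith.prod_fst.comp_lipschitzOnWith hlip).dimH_image_le.trans
      (dimH_mono (subset_univ S))).trans_lt ?_
    rw [Real.dimH_univ_eq_finrank]
    exact_mod_cast hdimker
  simpa using hausdorffMeasure_of_dimH_lt hlt

/-- Let `M` be a family of endomorphisms such that, whenever `M a` kills `w ≠ 0`, the derivative
of `M · w` at `a` is onto. Then `M a` is invertible for almost every `a`. -/
theorem hausdorffMeasure_setOf_det_eq_zero {E W : Type*} [NormedAddCommGroup E]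
    [NormedSpace ℝ E] [FiniteDimensional ℝ E] [MeasurableSpace E] [BorelSpace E]
    [NormedAddCommGroup W] [InnerProductSpace ℝ W] [FiniteDimensional ℝ W]
    {M : E → W →L[ℝ] W} {s : Set E}
    (hM : ∀ a ∈ s, ∀ w, ∃ L : E →L[ℝ] W, HasStrictFDerivAt (fun b => M b w) L a ∧
      (w ≠ 0 → M a w = 0 → Function.Surjective L)) :
    μH[Module.finrank ℝ E] {a ∈ s | (M a).det = 0} = 0 := by
  set d := Module.finrank ℝ E
  let Ψ : E × W → W × ℝ := fun p => (M p.1 p.2, ‖p.2‖ ^ 2)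
  set Z : Set (E × W) := {p | p.1 ∈ s ∧ Ψ p = (0, 1)}
  have hloc : ∀ p ∈ Z, ∃ U ∈ 𝓝 p, μH[d] (Prod.fst '' {q ∈ U | Ψ q = (0, 1)}) = 0 := by
    rintro ⟨a, w⟩ ⟨ha, hΨp⟩
    have hMw : M a w = 0 := congrArg Prod.fst hΨp
    have hw1 : ‖w‖ ^ 2 = 1 := congrArg Prod.snd hΨp
    have hw0 : w ≠ 0 := by
      rintro rfl
      simp at hw1
    let b := Module.finBasis ℝ W
    choose L hL hLsurj using hM a ha
    let coordL : Fin (Module.finrank ℝ W) → W →L[ℝ] ℝ := fun i =>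
      LinearMap.toContinuousLinearMap (b.coord i)
    have hexp : (fun p : E × W => M p.1 p.2) = fun p => ∑ i, coordL i p.2 • M p.1 (b i) := by
      funext p
      conv_lhs => rw [← b.sum_repr p.2]
      rw [map_sum]
      refine Finset.sum_congr rfl fun i _ => ?_
      rw [map_smul]
      rfl
    obtain ⟨D, hD⟩ : ∃ D : E × W →L[ℝ] W,
        HasStrictFDerivAt (fun p : E × W => M p.1 p.2) D (a, w) := by
      rw [hexp]
      refine ⟨_, HasStrictFDerivAt.fun_sum fun i _ => HasStrictFDerivAt.smul
        ((coordL i).hasStrictFDerivAt.comp (a, w) hasStrictFDerivAt_snd)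
        (HasStrictFDerivAt.comp (a, w) (f := Prod.fst) (hL (b i)) hasStrictFDerivAt_fst)⟩
    obtain ⟨N, hN⟩ : ∃ N : W →L[ℝ] ℝ, HasStrictFDerivAt (fun v : W => ‖v‖ ^ 2) N w :=
      ⟨_, (contDiff_norm_sq ℝ (n := 1)).contDiffAt.hasStrictFDerivAt one_ne_zero⟩
    have hDinl : ∀ v, D (v, 0) = L w v := by
      have h1 : HasFDerivAt (fun c : E => M c w) (D.comp (.inl ℝ E W)) a :=
        HasFDerivAt.comp (f := fun c : E => (c, w)) a hD.hasFDerivAt (hasFDerivAt_prodMk_left a w)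
      have h2 := h1.unique (hL w).hasFDerivAt
      intro v
      rw [← h2]
      simp
    have hNw : N w = 2 := by
      have h1 := hN.hasFDerivAt.unique (hasStrictFDerivAt_norm_sq w).hasFDerivAt
      rw [h1]
      simp [hw1]
    have hΨ : HasStrictFDerivAt Ψ (D.prod (N.comp (.snd ℝ E W))) (a, w) :=
      hD.prodMk (HasStrictFDerivAt.comp (g := fun v : W => ‖v‖ ^ 2) (a, w) hN hasStrictFDerivAt_snd)
    have hsurj : Function.Surjective (D.prod (N.comp (.snd ℝ E W))) := by
      rintro ⟨y, t⟩
      obtain ⟨v, hv⟩ := hLsurj w hw0 hMw (y - D (0, (t / 2) • w))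
      refine ⟨(v, (t / 2) • w), Prod.ext ?_ ?_⟩
      · have : ((v, (t / 2) • w) : E × W) = (v, 0) + (0, (t / 2) • w) := by simp
        change D (v, (t / 2) • w) = y
        rw [this, map_add, hDinl, hv, sub_add_cancel]
      · simp [hNw]
    have := exists_nhds_hausdorffMeasure_fst_image_eq_zero (by simp) hΨ hsurj
    rwa [hΨp] at this
  choose! U hU hU0 using hloc
  obtain ⟨t, htZ, htc, hcov⟩ := TopologicalSpace.countable_cover_nhdsWithin
    (f := U) (s := Z) fun p hp => mem_nhdsWithin_of_mem_nhds (hU p hp)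
  have hsub : {a ∈ s | (M a).det = 0} ⊆
      ⋃ p ∈ t, Prod.fst '' {q ∈ U p | Ψ q = (0, 1)} := by
    rintro a ⟨ha, hdet⟩
    obtain ⟨u, hu0, hu⟩ : ∃ u : W, u ≠ 0 ∧ M a u = 0 := by
      by_contra! hne
      have hker : (M a : W →ₗ[ℝ] W).ker = ⊥ :=
        LinearMap.ker_eq_bot'.2 fun u hu => by_contra fun h => hne u h hu
      exact (LinearMap.isUnit_det _ ((LinearMap.isUnit_iff_ker_eq_bot _).2 hker)).ne_zero hdet
    have hun : ‖u‖ ≠ 0 := norm_ne_zero_iff.2 hu0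
    have hmem : (a, ‖u‖⁻¹ • u) ∈ Z := by
      refine ⟨ha, Prod.ext ?_ ?_⟩
      · simp [Ψ, hu]
      · simp [Ψ, norm_smul, hun]
    obtain ⟨p, hpt, hp⟩ := mem_iUnion₂.1 (hcov hmem)
    exact mem_iUnion₂.2 ⟨p, hpt, _, ⟨hp, hmem.2⟩, rfl⟩
  exact measure_mono_null hsub ((measure_biUnion_null_iff htc).2 fun p hp => hU0 p (htZ hp))

/-- A bound on the second derivative gives uniform affine approximation on small balls. -/
theorem norm_image_sub_sub_fderiv_le {E G : Type*} [NormedAddCommGroup E] [NormedSpace ℝ E]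
    [NormedAddCommGroup G] [NormedSpace ℝ G] {h : E → G} {a : E} {C R : ℝ}
    (hd : ∀ b ∈ ball a R, DifferentiableAt ℝ h b)
    (hd' : ∀ b ∈ ball a R, DifferentiableAt ℝ (fun c => fderiv ℝ h c) b)
    (hC : ∀ b ∈ ball a R, ‖fderiv ℝ (fun c => fderiv ℝ h c) b‖ ≤ C) {r : ℝ} (hr : r ≤ R)
    {x y : E} (hx : x ∈ ball a r) (hy : y ∈ ball a r) :
    ‖h y - h x - fderiv ℝ h a (y - x)‖ ≤ C * r * ‖y - x‖ := by
  have hr0 : 0 < r := pos_of_mem_ball hx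
  have hsub : ball a r ⊆ ball a R := ball_subset_ball hr
  have ha : a ∈ ball a r := mem_ball_self hr0
  have hC0 : 0 ≤ C := (norm_nonneg (fderiv ℝ (fun c => fderiv ℝ h c) a)).trans (hC a (hsub ha))
  refine (convex_ball a r).norm_image_sub_le_of_norm_hasFDerivWithin_le'
    (f' := fun b => fderiv ℝ h b)
    (fun b hb => (hd b (hsub hb)).hasFDerivAt.hasFDerivWithinAt) (fun b hb => ?_) hx hy
  refine ((convex_ball a r).norm_image_sub_le_of_norm_fderiv_le (𝕜 := ℝ)
    (fun c hc => hd' c (hsub hc)) (fun c hc => hC c (hsub hc)) ha hb).trans ?_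
  gcongr
  exact (mem_ball_iff_norm.1 hb).le

theorem matrixOf_mulVec {l m : ℕ}
    (L : EuclideanSpace ℝ (Fin l) →L[ℝ] EuclideanSpace ℝ (Fin m)) (v : Fin l → ℝ) :
    matrixOf L *ᵥ v = L (WithLp.toLp 2 v) := by
  have hv : WithLp.toLp 2 v = ∑ j, v j • EuclideanSpace.single j (1 : ℝ) := by
    ext i
    simp [Finset.sum_apply, Pi.single_apply]
  ext i
  rw [hv, map_sum]
  simp [Matrix.mulVec, dotProduct, matrixOf, mul_comm]

theorem surjective_of_matrixOf_mul_transpose_det_ne_zero {l m : ℕ}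
    {L : EuclideanSpace ℝ (Fin l) →L[ℝ] EuclideanSpace ℝ (Fin m)}
    (hL : (matrixOf L * (matrixOf L)ᵀ).det ≠ 0) : Function.Surjective L := by
  intro y
  refine ⟨WithLp.toLp 2 ((matrixOf L)ᵀ *ᵥ ((matrixOf L * (matrixOf L)ᵀ)⁻¹ *ᵥ y.ofLp)), ?_⟩
  ext i
  rw [← matrixOf_mulVec, mulVec_mulVec, mulVec_mulVec, mul_nonsing_inv _ hL.isUnit, one_mulVec]

theorem matrixOf_continuous {l m : ℕ} : Continuous (matrixOf (l := l) (m := m)) := by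
  refine continuous_matrix fun i j => ?_
  unfold matrixOf
  fun_prop

namespace IsTransversalFamily

variable {l m n : ℕ} {Λ : Set (EuclideanSpace ℝ (Fin l))}
  {P : EuclideanSpace ℝ (Fin l) → EuclideanSpace ℝ (Fin n) → EuclideanSpace ℝ (Fin m)}

theorem differentiableAt (hP : IsTransversalFamily Λ P) (hΛ : IsOpen Λ)
    {a : EuclideanSpace ℝ (Fin l)} (ha : a ∈ Λ) (y : EuclideanSpace ℝ (Fin n)) :
    DifferentiableAt ℝ (fun p : _ × _ => P p.1 p.2) (a, y) := by
  have h := (hP _ (isCompact_closedBall y 1)).1.1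
  have hnhds : Λ ×ˢ closedBall y 1 ∈ 𝓝 (a, y) :=
    prod_mem_nhds (hΛ.mem_nhds ha) (closedBall_mem_nhds y one_pos)
  exact (h.contDiffAt hnhds).differentiableAt one_ne_zero

/-- The derivative of `P_λ` at `y`. -/
theorem hasFDerivAt (hP : IsTransversalFamily Λ P) (hΛ : IsOpen Λ)
    {a : EuclideanSpace ℝ (Fin l)} (ha : a ∈ Λ) (y : EuclideanSpace ℝ (Fin n)) :
    HasFDerivAt (P a)
      ((fderiv ℝ (fun p : _ × _ => P p.1 p.2) (a, y)).comp (.inr ℝ _ _)) y :=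
  HasFDerivAt.comp (f := fun z => (a, z)) y (hP.differentiableAt hΛ ha y).hasFDerivAt
    (hasFDerivAt_prodMk_right a y)

theorem differentiableAt_Tmap (hP : IsTransversalFamily Λ P)
    {a : EuclideanSpace ℝ (Fin l)} (ha : a ∈ Λ) (x y : EuclideanSpace ℝ (Fin n)) :
    DifferentiableAt ℝ (Tmap P x y) a := by
  have h := (hP {x, y} (Set.toFinite _).isCompact).1.2 a ha
  exact ((h x (by simp)).1.sub (h y (by simp)).1).const_smul ‖x - y‖⁻¹

theorem differentiableAt_fderiv_Tmap (hP : IsTransversalFamily Λ P) (hΛ : IsOpen Λ)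
    {a : EuclideanSpace ℝ (Fin l)} (ha : a ∈ Λ) (x y : EuclideanSpace ℝ (Fin n)) :
    DifferentiableAt ℝ (fun μ => fderiv ℝ (Tmap P x y) μ) a := by
  have h := fun b hb => (hP {x, y} (Set.toFinite _).isCompact).1.2 b hb
  have heq : (fun μ => fderiv ℝ (Tmap P x y) μ) =ᶠ[𝓝 a] fun μ =>
      ‖x - y‖⁻¹ • (fderiv ℝ (fun ν => P ν x) μ - fderiv ℝ (fun ν => P ν y) μ) := by
    filter_upwards [hΛ.mem_nhds ha] with b hb
    exact (((h b hb x (by simp)).1.hasFDerivAt.sub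
      (h b hb y (by simp)).1.hasFDerivAt).const_smul ‖x - y‖⁻¹).fderiv
  exact heq.differentiableAt_iff.2
    (((h a ha x (by simp)).2.sub (h a ha y (by simp)).2).const_smul ‖x - y‖⁻¹)

/-- The transversality condition passes to the limit `x → y` along a direction `v`. -/
theorem exists_hasStrictFDerivAt (hP : IsTransversalFamily Λ P) (hΛ : IsOpen Λ)
    {a : EuclideanSpace ℝ (Fin l)} (ha : a ∈ Λ) (y v : EuclideanSpace ℝ (Fin n)) :
    ∃ L : EuclideanSpace ℝ (Fin l) →L[ℝ] EuclideanSpace ℝ (Fin m),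
      HasStrictFDerivAt (fun b => fderiv ℝ (fun p : _ × _ => P p.1 p.2) (b, y) (0, v)) L a ∧
      (v ≠ 0 → fderiv ℝ (fun p : _ × _ => P p.1 p.2) (a, y) (0, v) = 0 →
        Function.Surjective L) := by
  set Q : EuclideanSpace ℝ (Fin l) → EuclideanSpace ℝ (Fin m) :=
    fun b => fderiv ℝ (fun p : _ × _ => P p.1 p.2) (b, y) (0, v)
  rcases eq_or_ne v 0 with rfl | hv
  · refine ⟨0, ?_, fun h => absurd rfl h⟩
    have : Q = fun _ => 0 := by
      funext b
      exact map_zero (fderiv ℝ (fun p : _ × _ => P p.1 p.2) (b, y))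
    rw [this]
    exact hasStrictFDerivAt_const _ _
  have hv0 : 0 < ‖v‖ := norm_pos_iff.2 hv
  let t : ℕ → ℝ := fun k => 1 / ((k : ℝ) + 1)
  have ht0 : ∀ k, 0 < t k := fun k => Nat.one_div_pos_of_nat
  have ht1 : ∀ k, t k ≤ 1 := fun k => by
    rw [div_le_one (by positivity)]
    linarith [Nat.cast_nonneg (α := ℝ) k]
  have htlim : Tendsto t atTop (𝓝 0) := tendsto_one_div_add_atTop_nhds_zero_nat
  let x : ℕ → EuclideanSpace ℝ (Fin n) := fun k => y + t k • v
  have hxy : ∀ k, x k - y = t k • v := fun k => add_sub_cancel_left _ _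
  have hxne : ∀ k, x k ≠ y := fun k h => by
    have := hxy k
    rw [h, sub_self] at this
    exact smul_ne_zero (ht0 k).ne' hv this.symm
  have hyK : y ∈ closedBall y ‖v‖ := mem_closedBall_self hv0.le
  have hxK : ∀ k, x k ∈ closedBall y ‖v‖ := fun k => by
    rw [mem_closedBall, dist_eq_norm, hxy, norm_smul, Real.norm_of_nonneg (ht0 k).le]
    exact mul_le_of_le_one_left hv0.le (ht1 k)
  obtain ⟨-, -, ⟨CT, hCT0, hCT⟩, CL, hCL⟩ := hP _ (isCompact_closedBall y ‖v‖)
  obtain ⟨R, hR, hRΛ⟩ := Metric.isOpen_iff.1 hΛ a ha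
  have hlim : ∀ b ∈ Λ, Tendsto (fun k => Tmap P (x k) y b) atTop (𝓝 (‖v‖⁻¹ • Q b)) := by
    intro b hb
    have h1 : HasDerivAt (fun s : ℝ => P b (y + s • v)) (Q b) 0 := by
      have hline : HasDerivAt (fun s : ℝ => y + s • v) v 0 := by
        simpa using ((hasDerivAt_id (0 : ℝ)).smul_const v).const_add y
      have hPb := hP.hasFDerivAt hΛ hb y
      exact HasFDerivAt.comp_hasDerivAt_of_eq (0 : ℝ) hPb hline (by simp)
    have h2 := (hasDerivAt_iff_tendsto_slope_zero.1 h1).comp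
      (tendsto_nhdsWithin_iff.2 ⟨htlim, Eventually.of_forall fun k => (ht0 k).ne'⟩)
    refine (h2.const_smul ‖v‖⁻¹).congr fun k => ?_
    simp only [Function.comp_apply, Tmap, hxy, norm_smul, Real.norm_of_nonneg (ht0 k).le,
      zero_add, zero_smul, add_zero, _root_.mul_inv_rev, smul_smul]
    rfl
  obtain ⟨L₀, φ, hφ, hL, hstrict⟩ := exists_hasStrictFDerivAt_of_tendsto
    (g := fun k => Tmap P (x k) y) (g₀ := fun b => ‖v‖⁻¹ • Q b)
    (L := fun k => fderiv ℝ (Tmap P (x k) y) a) (C := CL) hR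
    (fun k r hr b hb c hc => norm_image_sub_sub_fderiv_le
      (fun b hb => hP.differentiableAt_Tmap (hRΛ hb) _ _)
      (fun b hb => hP.differentiableAt_fderiv_Tmap hΛ (hRΛ hb) _ _)
      (fun b hb => hCL b (hRΛ hb) _ (hxK k) _ hyK (hxne k)) hr hb hc)
    (fun b hb => hlim b (hRΛ hb))
  refine ⟨‖v‖ • L₀, ?_, fun _ hQa => ?_⟩
  · refine (hstrict.const_smul ‖v‖).congr_of_eventuallyEq (Eventually.of_forall fun b => ?_)
    simp only [Pi.smul_apply, smul_smul, mul_inv_cancel₀ hv0.ne', one_smul]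
  · have hsmall : ∀ᶠ k in atTop, ‖Tmap P (x (φ k)) y a‖ ≤ CT := by
      have h1 := ((hlim a ha).comp hφ.tendsto_atTop).norm
      have hQa' : Q a = 0 := hQa
      rw [hQa', smul_zero, norm_zero] at h1
      exact (h1.eventually_lt_const hCT0).mono fun k hk => hk.le
    have hcont : Continuous fun A : EuclideanSpace ℝ (Fin l) →L[ℝ] EuclideanSpace ℝ (Fin m) =>
        (matrixOf A * (matrixOf A)ᵀ).det :=
      (matrixOf_continuous.matrix_mul matrixOf_continuous.matrix_transpose).matrix_det
    have hdet : CT ^ 2 ≤ (matrixOf L₀ * (matrixOf L₀)ᵀ).det :=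
      ge_of_tendsto ((hcont.tendsto L₀).comp hL) (hsmall.mono fun k hk =>
        hCT a ha _ (hxK _) _ hyK (hxne _) hk)
    have hsurj := surjective_of_matrixOf_mul_transpose_det_ne_zero
      ((pow_pos hCT0 2).trans_le hdet).ne'
    intro z
    obtain ⟨u, hu⟩ := hsurj (‖v‖⁻¹ • z)
    exact ⟨u, by simp [hu, smul_smul, hv0.ne']⟩

/-- For an injective linear map `A` into `ℝⁿ`, the derivative of `P_λ` restricted to the range of
`A` is invertible for almost every `λ`. -/
theorem ae_det_ne_zero (hP : IsTransversalFamily Λ P) (hΛ : IsOpen Λ)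
    (y : EuclideanSpace ℝ (Fin n))
    {A : EuclideanSpace ℝ (Fin m) →L[ℝ] EuclideanSpace ℝ (Fin n)} (hA : Function.Injective A) :
    ∀ᵐ a ∂(volume : Measure (EuclideanSpace ℝ (Fin l))), a ∈ Λ →
      (((fderiv ℝ (fun p : _ × _ => P p.1 p.2) (a, y)).comp
        (.inr ℝ _ _)).comp A).det ≠ 0 := by
  have h := hausdorffMeasure_setOf_det_eq_zero (s := Λ) (M := fun a =>
    ((fderiv ℝ (fun p : _ × _ => P p.1 p.2) (a, y)).comp (.inr ℝ _ _)).comp A) (by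
      intro a ha w
      obtain ⟨L, hL, hsurj⟩ := hP.exists_hasStrictFDerivAt hΛ ha y (A w)
      exact ⟨L, hL, fun hw hw0 => hsurj ((map_ne_zero_iff A hA).2 hw) hw0⟩)
  have hHaar : (μH[Module.finrank ℝ (EuclideanSpace ℝ (Fin l))] :
    Measure (EuclideanSpace ℝ (Fin l))).IsAddHaarMeasure := isAddHaarMeasure_hausdorffMeasure
  have hac : (volume : Measure (EuclideanSpace ℝ (Fin l))) ≪
      μH[Module.finrank ℝ (EuclideanSpace ℝ (Fin l))] :=
    Measure.absolutelyContinuous_isAddHaarMeasure _ _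
  rw [ae_iff]
  refine measure_mono_null (fun a ha => ?_) (hac h)
  simpa using ha

end IsTransversalFamily

/-- A Lipschitz map whose image of `S` has positive Hausdorff measure is differentiable with
injective derivative on a non-null part of `S`. -/
theorem LipschitzWith.hausdorffMeasure_injective_fderiv_ne_zero {E F : Type*}
    [NormedAddCommGroup E] [InnerProductSpace ℝ E] [FiniteDimensional ℝ E] [MeasurableSpace E]
    [BorelSpace E] [NormedAddCommGroup F] [NormedSpace ℝ F] [FiniteDimensional ℝ F]
    [MeasurableSpace F] [BorelSpace F] {K : ℝ≥0} {f : E → F} (hf : LipschitzWith K f) {S : Set E}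
    (hS : μH[Module.finrank ℝ E] (f '' S) ≠ 0) :
    μH[Module.finrank ℝ E]
      {x ∈ S | DifferentiableAt ℝ f x ∧ Function.Injective (fderiv ℝ f x)} ≠ 0 := by
  set d := Module.finrank ℝ E
  have hHaar : (μH[d] : Measure E).IsAddHaarMeasure := isAddHaarMeasure_hausdorffMeasure
  have hnull : ∀ u : Set E, μH[d] u = 0 → μH[d] (f '' u) = 0 := by
    intro u hu
    have := hf.hausdorffMeasure_image_le (Nat.cast_nonneg d) u
    rwa [hu, mul_zero, nonpos_iff_eq_zero] at this
  intro h0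
  apply hS
  have hsub : f '' S ⊆ f '' {x ∈ S | DifferentiableAt ℝ f x ∧ Function.Injective (fderiv ℝ f x)} ∪
      f '' {x | ¬ DifferentiableAt ℝ f x} ∪
      f '' {x | DifferentiableAt ℝ f x ∧ ¬ Function.Injective (fderiv ℝ f x)} := by
    rintro _ ⟨x, hx, rfl⟩
    by_cases h1 : DifferentiableAt ℝ f x
    · by_cases h2 : Function.Injective (fderiv ℝ f x)
      · exact Or.inl (Or.inl ⟨x, ⟨hx, h1, h2⟩, rfl⟩)
      · exact Or.inr ⟨x, ⟨h1, h2⟩, rfl⟩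
    · exact Or.inl (Or.inr ⟨x, h1, rfl⟩)
  have : SecondCountableTopology F := secondCountable_of_proper
  refine measure_mono_null hsub (measure_union_null (measure_union_null (hnull _ h0)
    (hnull _ (ae_iff.1 hf.ae_differentiableAt))) ?_)
  exact hausdorffMeasure_image_eq_zero_of_fderivWithin_not_injective (f' := fderiv ℝ f)
    (fun x hx => hx.1.hasFDerivAt.hasFDerivWithinAt) fun x hx => hx.2

/-- For a transversal family `{P_λ}_{λ∈Λ}` of maps `ℝⁿ → ℝ^m` and an `H^m`-measurable,
`m`-rectifiable set `F ⊆ ℝⁿ` with `H^m(F) > 0`, one has `H^m(P_λ(F)) > 0` for `L^l`-almost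
every `λ ∈ Λ`. -/
theorem rectifiable_ae_proj_pos {l m n : ℕ} (hml : m ≤ l) (hmn : m < n)
    (Λ : Set (EuclideanSpace ℝ (Fin l))) (hΛ : IsOpen Λ)
    (P : EuclideanSpace ℝ (Fin l) → EuclideanSpace ℝ (Fin n) → EuclideanSpace ℝ (Fin m))
    (hP : IsTransversalFamily Λ P)
    (F : Set (EuclideanSpace ℝ (Fin n))) (hF : MeasurableSet F)
    (hFrect : MRectifiable m n F) (hFpos : 0 < μH[m] F) :
    ∀ᵐ lam ∂(volume : Measure (EuclideanSpace ℝ (Fin l))), lam ∈ Λ →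
      0 < μH[m] (P lam '' F) := by
  have hfin : Module.finrank ℝ (EuclideanSpace ℝ (Fin m)) = m := finrank_euclideanSpace_fin
  have hHaar : (μH[m] : Measure (EuclideanSpace ℝ (Fin m))).IsAddHaarMeasure := by
    have := isAddHaarMeasure_hausdorffMeasure (E := EuclideanSpace ℝ (Fin m))
    rwa [hfin] at this
  obtain ⟨f, hf, hf0⟩ := hFrect
  obtain ⟨i, hi⟩ : ∃ i, μH[m] (F ∩ range (f i)) ≠ 0 := by
    by_contra! hall
    refine hFpos.ne' (measure_mono_null ?_ (measure_union_null (measure_iUnion_null hall) hf0))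
    rw [← inter_iUnion, inter_union_sdiff]
  obtain ⟨K, hK⟩ := hf i
  generalize f i = f at hi hK
  set S := {x ∈ f ⁻¹' F | DifferentiableAt ℝ f x ∧ Function.Injective (fderiv ℝ f x)}
  have hSpos : μH[m] S ≠ 0 := by
    have h := hK.hausdorffMeasure_injective_fderiv_ne_zero (S := f ⁻¹' F)
    rw [hfin, image_preimage_eq_inter_range] at h
    exact h hi
  have hSmeas : MeasurableSet S :=
    (hK.continuous.measurable hF).inter ((measurableSet_of_differentiableAt ℝ f).inter
      (measurable_fderiv ℝ f ContinuousLinearMap.isOpen_injective.measurableSet))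
  let D : EuclideanSpace ℝ (Fin l) → EuclideanSpace ℝ (Fin m) →
      EuclideanSpace ℝ (Fin m) →L[ℝ] EuclideanSpace ℝ (Fin m) := fun a x =>
    ((fderiv ℝ (fun p : _ × _ => P p.1 p.2) (a, f x)).comp (.inr ℝ _ _)).comp (fderiv ℝ f x)
  have hDmeas : Measurable fun q : EuclideanSpace ℝ (Fin l) × EuclideanSpace ℝ (Fin m) =>
      (D q.1 q.2).det := by
    have h1 : Measurable fun q : EuclideanSpace ℝ (Fin l) × EuclideanSpace ℝ (Fin m) =>
        fderiv ℝ (fun p : _ × _ => P p.1 p.2) (q.1, f q.2) :=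
      (measurable_fderiv ℝ _).comp
        (measurable_fst.prodMk (hK.continuous.measurable.comp measurable_snd))
    have h2 : Measurable fun q : EuclideanSpace ℝ (Fin l) × EuclideanSpace ℝ (Fin m) =>
        fderiv ℝ f q.2 := (measurable_fderiv ℝ f).comp measurable_snd
    have hcont : Continuous fun B : (EuclideanSpace ℝ (Fin l) × EuclideanSpace ℝ (Fin n) →L[ℝ]
        EuclideanSpace ℝ (Fin m)) × (EuclideanSpace ℝ (Fin m) →L[ℝ] EuclideanSpace ℝ (Fin n)) =>
        ((B.1.comp (.inr ℝ _ _)).comp B.2).det :=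
      ContinuousLinearMap.continuous_det.comp (by fun_prop)
    exact hcont.measurable.comp (h1.prodMk h2)
  have hmeas : MeasurableSet {q : EuclideanSpace ℝ (Fin l) × EuclideanSpace ℝ (Fin m) |
      q.1 ∈ Λ → q.2 ∈ S → (D q.1 q.2).det ≠ 0} := by
    have h1 : MeasurableSet {q : EuclideanSpace ℝ (Fin l) × EuclideanSpace ℝ (Fin m) |
      q.1 ∈ Λ} := measurable_fst hΛ.measurableSet
    have h2 : MeasurableSet {q : EuclideanSpace ℝ (Fin l) × EuclideanSpace ℝ (Fin m) |
      q.2 ∈ S} := measurable_snd hSmeas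
    have h3 : MeasurableSet {q : EuclideanSpace ℝ (Fin l) × EuclideanSpace ℝ (Fin m) |
      (D q.1 q.2).det ≠ 0} := hDmeas (measurableSet_singleton 0).compl
    exact h1.imp (h2.imp h3)
  have hae : ∀ᵐ a ∂(volume : Measure (EuclideanSpace ℝ (Fin l))),
      ∀ᵐ x ∂(μH[m] : Measure (EuclideanSpace ℝ (Fin m))), a ∈ Λ → x ∈ S → (D a x).det ≠ 0 := by
    rw [Measure.ae_ae_comm hmeas]
    refine Eventually.of_forall fun x => ?_
    by_cases hx : x ∈ S
    · filter_upwards [hP.ae_det_ne_zero hΛ (f x) hx.2.2] with a ha haΛ _ using ha haΛ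
    · exact Eventually.of_forall fun a _ h => absurd h hx
  filter_upwards [hae] with a ha haΛ
  rw [pos_iff_ne_zero]
  intro himg
  have hgood : μH[m] {x ∈ S | (D a x).det ≠ 0} = 0 := by
    refine addHaar_eq_zero_of_addHaar_image_eq_zero μH[m] (g := P a ∘ f) (g' := D a)
      (fun x hx => ?_) (fun x hx => hx.2) (measure_mono_null ?_ himg)
    · exact ((hP.hasFDerivAt hΛ haΛ (f x)).comp x hx.1.2.1.hasFDerivAt).hasFDerivWithinAt
    · rintro _ ⟨x, hx, rfl⟩
      exact ⟨f x, hx.1.1, rfl⟩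
  refine hSpos (measure_mono_null (fun x hx => ?_) (measure_union_null hgood (ae_iff.1 ha)))
  by_cases hdet : (D a x).det = 0
  · exact Or.inr fun h => h haΛ hx hdet
  · exact Or.inl ⟨hx, hdet⟩
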